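/- Let E ⊇ F be fields, V an E-vector space, C an E-subspace of V of codimension 1, and W an F-subspace of V with W ⊄ C. If φ, ψ: V → E are E-linear maps with ker φ = ker ψ = C, 1 ∈ φ(W) and 1 ∈ ψ(W), then the subfield of E generated by φ(W) equals the subfield of E generated by ψ(W); moreover this common subfield F⟨W,C⟩ contains F. -/

import Mathlib

set_option synthInstance.maxHeartbeats 1000000
set_option maxHeartbeats 1000000

section Defs

variable (R : Type*) [Field R] {M : Type*} [LieRing M] [Module R M]

/-- The graded pieces of the Lie subalgebra generated in degree 1 by `L1`:
`gradedPieces R L1 1 = L1` and `gradedPieces R L1 (i+1) = [gradedPieces R L1 i, L1]`. -/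
def gradedPieces (L1 : Submodule R M) : ℕ → Submodule R M
  | 0 => ⊥
  | 1 => L1
  | (n + 2) => Submodule.span R
      {z | ∃ x ∈ gradedPieces L1 (n + 1), ∃ y ∈ L1, z = ⁅x, y⁆}

/-- Iterated bracketing with `L1`, starting from `X0`:
`bracketIter R L1 X0 (j+1) = [bracketIter R L1 X0 j, L1]`. -/
def bracketIter (L1 X0 : Submodule R M) : ℕ → Submodule R M
  | 0 => X0
  | (j + 1) => Submodule.span R
      {z | ∃ x ∈ bracketIter L1 X0 j, ∃ y ∈ L1, z = ⁅x, y⁆}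

/-- `gr` is the grading of a graded Lie algebra `⊕_{i ≥ 1} gr i`, generated by its
first homogeneous component. -/
structure IsGradedLie (gr : ℕ → Submodule R M) : Prop where
  bot : gr 0 = ⊥
  internal : DirectSum.IsInternal gr
  bracket_mem : ∀ i j, ∀ x ∈ gr i, ∀ y ∈ gr j, ⁅x, y⁆ ∈ gr (i + j)
  gen : ∀ i, 1 ≤ i → gr (i + 1) =
    Submodule.span R {z | ∃ x ∈ gr i, ∃ y ∈ gr 1, z = ⁅x, y⁆}

/-- `J` is a graded ideal of the graded Lie algebra with grading `gr`, presented via its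
homogeneous components `J i = J ∩ gr i`. -/
def IsGradedIdealFam (gr J : ℕ → Submodule R M) : Prop :=
  (∀ i, J i ≤ gr i) ∧ ∀ i j, ∀ z ∈ J i, ∀ x ∈ gr j, ⁅z, x⁆ ∈ J (i + j)

/-- The graded Lie algebra with grading `gr` is ideally `r`-constrained: every nonzero
graded ideal `J` satisfies `L^i ⊇ J ⊇ L^(i+r)` for some `i`. -/
def IdeallyConstrained (gr : ℕ → Submodule R M) (r : ℕ) : Prop :=
  ∀ J : ℕ → Submodule R M, IsGradedIdealFam R gr J → (∃ i, J i ≠ ⊥) →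
    ∃ i, (∀ j, j < i → J j = ⊥) ∧ ∀ j, i + r ≤ j → J j = gr j

/-- The graded Lie algebra with grading `gr` is just infinite: every nonzero graded ideal
has finite codimension. -/
def JustInfinite (gr : ℕ → Submodule R M) : Prop :=
  ∀ J : ℕ → Submodule R M, IsGradedIdealFam R gr J → (∃ i, J i ≠ ⊥) →
    FiniteDimensional R (↥(⨆ i, gr i) ⧸ ((⨆ i, J i).comap (⨆ i, gr i).subtype))

end Defs

section MaxClass

variable (E : Type*) [Field E] {M : Type*} [LieRing M] [LieAlgebra E M]

/-- `gr` is the grading of a Lie algebra of maximal class over `E`. -/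
structure IsMaxClass (gr : ℕ → Submodule E M) : Prop where
  graded : IsGradedLie E gr
  dim_one : Module.finrank E ↥(gr 1) = 2
  dim_ge_two : ∀ i, 2 ≤ i → Module.finrank E ↥(gr i) = 1

/-- The `i`-th two-step centraliser `C_i = C_{M_1}(M_i)`. -/
def twoStepCent (gr : ℕ → Submodule E M) (i : ℕ) : Submodule E M :=
  gr 1 ⊓ ⨅ m : ↥(gr i), LinearMap.ker (LieAlgebra.ad E M (m : M))

end MaxClass

/-- The set `E_s` of scalars stabilising a subset `s` of an `E`-vector space. -/
def scalarStab (E : Type*) [Field E] {M : Type*} [AddCommGroup M] [Module E M]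
    (s : Set M) : Set E := {α | ∀ v ∈ s, α • v ∈ s}


/-- Two linear functionals with the same kernel are proportional; if `φ` takes the value `1` on `W`,
the factor is a value of `ψ` on `W`. -/
theorem closure_image_le_of_ker_eq {E V : Type*} [Field E] [AddCommGroup V] [Module E V]
    {W : Set V} {φ ψ : V →ₗ[E] E} (hker : LinearMap.ker φ = LinearMap.ker ψ)
    (h1 : (1 : E) ∈ φ '' W) :
    Subfield.closure (φ '' W) ≤ Subfield.closure (ψ '' W) := by
  obtain ⟨w, hw, hw1⟩ := h1
  have hw0 : ψ w ≠ 0 := fun h => by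
    have hmem : w ∈ LinearMap.ker φ := by rw [hker]; exact h
    rw [LinearMap.mem_ker, hw1] at hmem
    exact one_ne_zero hmem
  rw [Subfield.closure_le]
  rintro _ ⟨x, hx, rfl⟩
  have hmem : x - φ x • w ∈ LinearMap.ker ψ := by
    rw [← hker, LinearMap.mem_ker]
    simp [hw1]
  have hx_eq : φ x = ψ x / ψ w := by
    rw [LinearMap.mem_ker, map_sub, map_smul, smul_eq_mul, sub_eq_zero] at hmem
    rw [hmem, mul_div_cancel_right₀ _ hw0]
  rw [SetLike.mem_coe, hx_eq]
  exact div_mem (Subfield.subset_closure ⟨x, hx, rfl⟩) (Subfield.subset_closure ⟨w, hw, rfl⟩)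

/-- If a functional takes the value `1` on an `F`-subspace, its values there include `F`. -/
theorem range_algebraMap_subset_image {F E V : Type*} [Field F] [Field E] [Algebra F E]
    [AddCommGroup V] [Module E V] [Module F V] [IsScalarTower F E V]
    {W : Submodule F V} {φ : V →ₗ[E] E} (h1 : (1 : E) ∈ φ '' (W : Set V)) :
    Set.range (algebraMap F E) ⊆ φ '' (W : Set V) := by
  obtain ⟨w, hw, hw1⟩ := h1
  rintro _ ⟨a, rfl⟩
  exact ⟨a • w, W.smul_mem a hw, by
    rw [← algebraMap_smul E a w, map_smul, hw1, smul_eq_mul, mul_one]⟩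

/-- Adjoining a set that already contains the base field gives the subfield it generates. -/
theorem adjoin_toSubfield_eq_closure {F E : Type*} [Field F] [Field E] [Algebra F E] {S : Set E}
    (hS : Set.range (algebraMap F E) ⊆ S) :
    (IntermediateField.adjoin F S).toSubfield = Subfield.closure S := by
  rw [IntermediateField.adjoin_toSubfield, Set.union_eq_self_of_subset_left hS]

theorem fieldext_welldefined (F E : Type*) [Field F] [Field E] [Algebra F E]
    (V : Type*) [AddCommGroup V] [Module E V] [Module F V] [IsScalarTower F E V]
    (C : Submodule E V) (hC : Module.finrank E (V ⧸ C) = 1)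
    (W : Submodule F V) (hW : ¬ (W : Set V) ⊆ (C : Set V))
    (φ ψ : V →ₗ[E] E) (hφ : LinearMap.ker φ = C) (hψ : LinearMap.ker ψ = C)
    (h1φ : (1 : E) ∈ ⇑φ '' (W : Set V)) (h1ψ : (1 : E) ∈ ⇑ψ '' (W : Set V)) :
    IntermediateField.adjoin F (⇑φ '' (W : Set V)) =
      IntermediateField.adjoin F (⇑ψ '' (W : Set V)) ∧
    Set.range (algebraMap F E) ⊆ (IntermediateField.adjoin F (⇑φ '' (W : Set V)) : Set E) := by
  have hker : LinearMap.ker φ = LinearMap.ker ψ := hφ.trans hψ.symm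
  have hF := range_algebraMap_subset_image h1φ
  refine ⟨IntermediateField.toSubfield_injective ?_, hF.trans (IntermediateField.subset_adjoin F _)⟩
  rw [adjoin_toSubfield_eq_closure hF,
    adjoin_toSubfield_eq_closure (range_algebraMap_subset_image h1ψ)]
  exact le_antisymm (closure_image_le_of_ker_eq hker h1φ)
    (closure_image_le_of_ker_eq hker.symm h1ψ)
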